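/- arXiv:0902.4454 — 4 statements merged into one kernel-verified Lean document; each statement's English description precedes it below -/
import Mathlib

section
/- The stabilizer Stab(x⁴ + 2√−3·x²y² + y⁴) ⊂ SL(2,ℂ) equals the subgroup generated by diag(i,−i), [[0,i],[i,0]], and (1/2)[[1+i, −1+i],[1+i, 1−i]] (the binary tetrahedral group T, of order 24). -/
open MvPolynomial Matrix

noncomputable section

/-- Polynomials in two variables `x = X 0`, `y = X 1` over `ℂ`. -/
abbrev BPoly : Type := MvPolynomial (Fin 2) ℂ

/-- The variable `x`. -/
def Px : BPoly := X 0

/-- The variable `y`. -/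
def Py : BPoly := X 1

/-- Substitution action of a 2×2 matrix on polynomials in two variables:
for `A = [[p,q],[r,s]]`, `(f·A)(x,y) = f(px+qy, rx+sy)`. -/
def matAct (A : Matrix (Fin 2) (Fin 2) ℂ) (f : BPoly) : BPoly :=
  bind₁ (fun i => C (A i 0) * Px + C (A i 1) * Py) f

/-- `f` is semi-invariant under `A`: `f·A = c·f` for some nonzero scalar `c`. -/
def SemiInv (A : Matrix (Fin 2) (Fin 2) ℂ) (f : BPoly) : Prop :=
  ∃ c : ℂ, c ≠ 0 ∧ matAct A f = C c * f

/-- The stabilizer of `f` inside `SL(2,ℂ)`: all matrices under which `f` is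
semi-invariant. -/
def Stab (f : BPoly) : Set (SpecialLinearGroup (Fin 2) ℂ) :=
  {A | SemiInv (A : Matrix (Fin 2) (Fin 2) ℂ) f}

/-- `f` is a (nonzero) binary form: nonzero and homogeneous of some degree. -/
def IsBinaryForm (f : BPoly) : Prop :=
  f ≠ 0 ∧ ∃ d : ℕ, f.IsHomogeneous d

/-- `f` is `SL(2,ℂ)`-equivalent to `g` up to a nonzero scalar:
`c·(f·A) = g` for some `A ∈ SL(2,ℂ)` and `c ≠ 0`. -/
def EquivForm (f g : BPoly) : Prop :=
  ∃ A : SpecialLinearGroup (Fin 2) ℂ, ∃ c : ℂ, c ≠ 0 ∧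
    C c * matAct (A : Matrix (Fin 2) (Fin 2) ℂ) f = g
/-- Semi-invariance tested on values: `f·A = c·f` as functions on `ℂ²`. -/
lemma mem_Stab_iff {f : BPoly} {A : SpecialLinearGroup (Fin 2) ℂ} :
    A ∈ Stab f ↔ ∃ c : ℂ, c ≠ 0 ∧
      ∀ v : Fin 2 → ℂ, eval ((A : Matrix (Fin 2) (Fin 2) ℂ) *ᵥ v) f = c * eval v f := by
  have key (v : Fin 2 → ℂ) : eval v (matAct (A : Matrix (Fin 2) (Fin 2) ℂ) f) =
      eval ((A : Matrix (Fin 2) (Fin 2) ℂ) *ᵥ v) f := by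
    rw [matAct, ← coe_aeval_eq_eval, RingHom.coe_coe, aeval_bind₁, ← coe_aeval_eq_eval,
      RingHom.coe_coe]
    congr 2
    funext i
    simp [Px, Py, mulVec, dotProduct, Fin.sum_univ_two]
  refine exists_congr fun c => and_congr_right fun _ => ⟨fun h v => ?_, fun h => ?_⟩
  · rw [← key, h, map_mul, eval_C]
  · exact MvPolynomial.funext fun v => by rw [key, h, map_mul, eval_C]

/-- The stabilizer of `f` as a subgroup of `SL(2,ℂ)`. -/
def stabSubgroup (f : BPoly) : Subgroup (SpecialLinearGroup (Fin 2) ℂ) where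
  carrier := Stab f
  one_mem' := mem_Stab_iff.2 ⟨1, one_ne_zero, fun v => by simp⟩
  mul_mem' {A B} hA hB := by
    obtain ⟨a, ha, hA⟩ := mem_Stab_iff.1 hA
    obtain ⟨b, hb, hB⟩ := mem_Stab_iff.1 hB
    refine mem_Stab_iff.2 ⟨a * b, mul_ne_zero ha hb, fun v => ?_⟩
    rw [Matrix.SpecialLinearGroup.coe_mul, ← mulVec_mulVec, hA, hB, mul_assoc]
  inv_mem' {A} hA := by
    obtain ⟨a, ha, hA⟩ := mem_Stab_iff.1 hA
    refine mem_Stab_iff.2 ⟨a⁻¹, inv_ne_zero ha, fun v => ?_⟩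
    have h := hA ((A⁻¹ : SpecialLinearGroup (Fin 2) ℂ).1 *ᵥ v)
    rw [mulVec_mulVec, ← Matrix.SpecialLinearGroup.coe_mul, mul_inv_cancel,
      Matrix.SpecialLinearGroup.coe_one, one_mulVec] at h
    rw [h, inv_mul_cancel_left₀ ha]

/-- The quartic `x⁴ + 2t x²y² + y⁴`. -/
abbrev quartic (t : ℂ) : BPoly := Px ^ 4 + C (2 * t) * Px ^ 2 * Py ^ 2 + Py ^ 4

lemma mem_Stab_quartic_iff {t : ℂ} {A : SpecialLinearGroup (Fin 2) ℂ} :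
    A ∈ Stab (quartic t) ↔ ∃ c : ℂ, c ≠ 0 ∧ ∀ x y : ℂ,
      (A 0 0 * x + A 0 1 * y) ^ 4 +
        2 * t * (A 0 0 * x + A 0 1 * y) ^ 2 * (A 1 0 * x + A 1 1 * y) ^ 2 +
        (A 1 0 * x + A 1 1 * y) ^ 4 = c * (x ^ 4 + 2 * t * x ^ 2 * y ^ 2 + y ^ 4) := by
  rw [mem_Stab_iff]
  refine exists_congr fun c => and_congr_right fun _ => ⟨fun h x y => ?_, fun h v => ?_⟩
  · simpa [quartic, Px, Py, mulVec, dotProduct, Fin.sum_univ_two] using h ![x, y]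
  · simpa [quartic, Px, Py, mulVec, dotProduct, Fin.sum_univ_two] using h (v 0) (v 1)

/-- Comparing coefficients in `f·A = c·f`. -/
lemma quartic_coeffs {t p q r s c : ℂ}
    (h : ∀ x y : ℂ, (p * x + q * y) ^ 4 + 2 * t * (p * x + q * y) ^ 2 * (r * x + s * y) ^ 2 +
      (r * x + s * y) ^ 4 = c * (x ^ 4 + 2 * t * x ^ 2 * y ^ 2 + y ^ 4)) :
    p ^ 4 + 2 * t * p ^ 2 * r ^ 2 + r ^ 4 = c ∧
    p ^ 3 * q + t * (p * r * (p * s + q * r)) + r ^ 3 * s = 0 ∧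
    3 * p ^ 2 * q ^ 2 + t * (p ^ 2 * s ^ 2 + 4 * p * q * r * s + q ^ 2 * r ^ 2) +
      3 * r ^ 2 * s ^ 2 = t * c ∧
    p * q ^ 3 + t * (q * s * (p * s + q * r)) + r * s ^ 3 = 0 ∧
    q ^ 4 + 2 * t * q ^ 2 * s ^ 2 + s ^ 4 = c := by
  have h₁ := h 1 0
  have h₂ := h 0 1
  have h₃ := h 1 1
  have h₄ := h 1 (-1)
  have h₅ := h 1 2
  have h₆ := h 1 (-2)
  refine ⟨?_, ?_, ?_, ?_, ?_⟩
  · linear_combination h₁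
  · linear_combination (h₃ - h₄) / 6 - (h₅ - h₆) / 48
  · linear_combination (h₃ + h₄) / 4 - h₁ / 2 - h₂ / 2
  · linear_combination (h₅ - h₆) / 48 - (h₃ - h₄) / 24
  · linear_combination h₂

/-- The sextic covariant `xy(x⁴ - y⁴)` of the quartic vanishes at the first column of a matrix
in the stabilizer. -/
lemma sextic_covariant_eq_zero {t p q r s : ℂ} (ht : t ^ 2 = -3) (hdet : p * s - q * r = 1)
    (h₁ : p ^ 3 * q + t * (p * r * (p * s + q * r)) + r ^ 3 * s = 0)
    (h₃ : p * q ^ 3 + t * (q * s * (p * s + q * r)) + r * s ^ 3 = 0) :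
    p * r * (p ^ 4 - r ^ 4) = 0 := by
  set a := p ^ 4 + 2 * t * p ^ 2 * r ^ 2 + r ^ 4 with ha
  set b := p ^ 3 * q + t * (p * r * (p * s + q * r)) + r ^ 3 * s with hb
  set m := 3 * p ^ 2 * q ^ 2 + t * (p ^ 2 * s ^ 2 + 4 * p * q * r * s + q ^ 2 * r ^ 2) +
      3 * r ^ 2 * s ^ 2 with hm
  set d := p * q ^ 3 + t * (q * s * (p * s + q * r)) + r * s ^ 3 with hd
  have key : a ^ 2 * d - a * b * m + 2 * b ^ 3 =
      (1 - t ^ 2) * (p * s - q * r) ^ 3 * (p * r * (p ^ 4 - r ^ 4)) := by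
    rw [ha, hb, hm, hd]
    ring
  rw [h₁, h₃, hdet, ht] at key
  linear_combination -key / 4

/-- The three possible values of `2 M₃ᵏ` for `k < 3`, over the Gaussian integers. -/
def gaussianM₃ : Fin 3 → Matrix (Fin 2) (Fin 2) GaussianInt :=
  ![!![2, 0; 0, 2], !![⟨1, 1⟩, ⟨-1, 1⟩; ⟨1, 1⟩, ⟨1, -1⟩],
    !![⟨-1, 1⟩, ⟨-1, 1⟩; ⟨1, 1⟩, ⟨-1, -1⟩]]

/-- The matrices `2 M₃ᵏ M₂ʲ M₁ⁱ` over the Gaussian integers. -/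
def gaussianWord (w : Fin 3 × Fin 2 × Fin 4) : Matrix (Fin 2) (Fin 2) GaussianInt :=
  gaussianM₃ w.1 * !![0, ⟨0, 1⟩; ⟨0, 1⟩, 0] ^ (w.2.1 : ℕ) *
    !![⟨0, 1⟩, 0; 0, ⟨0, -1⟩] ^ (w.2.2 : ℕ)

lemma gaussianWord_injective : Function.Injective gaussianWord := by
  decide +kernel

section Generators

variable {M₁ M₂ M₃ : SpecialLinearGroup (Fin 2) ℂ}

lemma word_injective
    (hM₁ : (M₁ : Matrix (Fin 2) (Fin 2) ℂ) = !![Complex.I, 0; 0, -Complex.I])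
    (hM₂ : (M₂ : Matrix (Fin 2) (Fin 2) ℂ) = !![0, Complex.I; Complex.I, 0])
    (hM₃ : (M₃ : Matrix (Fin 2) (Fin 2) ℂ) =
      !![(1 + Complex.I) / 2, (-1 + Complex.I) / 2;
         (1 + Complex.I) / 2, (1 - Complex.I) / 2]) :
    Function.Injective fun w : Fin 3 × Fin 2 × Fin 4 =>
      M₃ ^ (w.1 : ℕ) * M₂ ^ (w.2.1 : ℕ) * M₁ ^ (w.2.2 : ℕ) := by
  have h₁ : (M₁ : Matrix (Fin 2) (Fin 2) ℂ) =
      GaussianInt.toComplex.mapMatrix !![⟨0, 1⟩, 0; 0, ⟨0, -1⟩] := by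
    rw [hM₁]
    ext i j
    fin_cases i <;> fin_cases j <;> simp [GaussianInt.toComplex_def₂, Complex.ext_iff]
  have h₂ : (M₂ : Matrix (Fin 2) (Fin 2) ℂ) =
      GaussianInt.toComplex.mapMatrix !![0, ⟨0, 1⟩; ⟨0, 1⟩, 0] := by
    rw [hM₂]
    ext i j
    fin_cases i <;> fin_cases j <;> simp [GaussianInt.toComplex_def₂, Complex.ext_iff]
  have h₃ (k : Fin 3) : (2 : ℂ) • (M₃ : Matrix (Fin 2) (Fin 2) ℂ) ^ (k : ℕ) =
      GaussianInt.toComplex.mapMatrix (gaussianM₃ k) := by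
    rw [hM₃]
    ext i j
    fin_cases k <;> fin_cases i <;> fin_cases j <;>
      norm_num [gaussianM₃, GaussianInt.toComplex_def₂, Complex.ext_iff, pow_two,
        Matrix.mul_apply, Fin.sum_univ_two]
  have key (w : Fin 3 × Fin 2 × Fin 4) :
      (2 : ℂ) • ((M₃ ^ (w.1 : ℕ) * M₂ ^ (w.2.1 : ℕ) * M₁ ^ (w.2.2 : ℕ) :
        SpecialLinearGroup (Fin 2) ℂ) : Matrix (Fin 2) (Fin 2) ℂ) =
      GaussianInt.toComplex.mapMatrix (gaussianWord w) := by
    rw [gaussianWord, map_mul, map_mul, map_pow, map_pow, ← h₁, ← h₂, ← h₃]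
    simp only [Matrix.SpecialLinearGroup.coe_mul, Matrix.SpecialLinearGroup.coe_pow, smul_mul_assoc]
  intro w w' h
  dsimp only at h
  refine gaussianWord_injective
    (Matrix.map_injective (f := GaussianInt.toComplex) (fun _ _ => GaussianInt.toComplex_inj.1) ?_)
  have h' := key w
  rw [h, key w'] at h'
  exact h'.symm

/-- Upper triangular elements of the stabilizer are powers of `diag(i,-i)`. -/
lemma eq_pow_of_mem_Stab {t : ℂ} (ht : t ^ 2 = -3)
    (hM₁ : (M₁ : Matrix (Fin 2) (Fin 2) ℂ) = !![Complex.I, 0; 0, -Complex.I])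
    {A : SpecialLinearGroup (Fin 2) ℂ} (hA : A ∈ stabSubgroup (quartic t))
    (hr : A 1 0 = 0) : ∃ i : Fin 4, A = M₁ ^ (i : ℕ) := by
  obtain ⟨c, -, h⟩ := mem_Stab_quartic_iff.1 hA
  obtain ⟨h₀, h₁, h₂, -, -⟩ := quartic_coeffs h
  have hdet := A.det_coe
  rw [det_fin_two] at hdet
  have ht0 : t ≠ 0 := by
    rintro rfl
    norm_num at ht
  rw [hr] at h₀ h₁ h₂ hdet
  have hps : A 0 0 * A 1 1 = 1 := by linear_combination hdet
  have hp : A 0 0 ≠ 0 := left_ne_zero_of_mul_eq_one hps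
  have hq : A 0 1 = 0 := by
    have : A 0 0 ^ 3 * A 0 1 = 0 := by linear_combination h₁
    simpa [hp] using this
  rw [hq] at h₂
  have hp4 : A 0 0 ^ 4 = 1 :=
    mul_left_cancel₀ ht0 (by linear_combination t * h₀ - h₂ + t * (A 0 0 * A 1 1 + 1) * hps)
  have hs : A 1 1 = A 0 0 ^ 3 :=
    mul_left_cancel₀ hp (by linear_combination hps - hp4)
  have hI := Complex.I_sq
  have of_eq (i : Fin 4) (hi : A 0 0 = Complex.I ^ (i : ℕ)) : A = M₁ ^ (i : ℕ) := by
    have hd : (M₁ : Matrix (Fin 2) (Fin 2) ℂ) = diagonal ![Complex.I, -Complex.I] := by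
      rw [hM₁]
      ext i j
      fin_cases i <;> fin_cases j <;> rfl
    ext j k
    rw [Matrix.SpecialLinearGroup.coe_pow, hd, diagonal_pow]
    fin_cases j <;> fin_cases k
    · simpa using hi
    · simpa using hq
    · simpa using hr
    · have : A 1 1 = (-Complex.I) ^ (i : ℕ) := by
        rw [hs, hi, ← pow_mul, mul_comm, pow_mul, Complex.I_pow_three]
      simpa using this
  have hfac : (A 0 0 - 1) * ((A 0 0 + 1) * ((A 0 0 - Complex.I) * (A 0 0 + Complex.I))) = 0 := by
    linear_combination hp4 - (A 0 0 ^ 2 - 1) * hI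
  rcases mul_eq_zero.1 hfac with h | h
  · exact ⟨0, of_eq 0 (by simpa using sub_eq_zero.1 h)⟩
  rcases mul_eq_zero.1 h with h | h
  · exact ⟨2, of_eq 2 (by simpa using eq_neg_of_add_eq_zero_left h)⟩
  rcases mul_eq_zero.1 h with h | h
  · exact ⟨1, of_eq 1 (by simpa using sub_eq_zero.1 h)⟩
  · exact ⟨3, of_eq 3 (by simpa using eq_neg_of_add_eq_zero_left h)⟩

lemma generators_mem_stabSubgroup {t : ℂ} (ht : t ^ 2 = -3)
    (hM₁ : (M₁ : Matrix (Fin 2) (Fin 2) ℂ) = !![Complex.I, 0; 0, -Complex.I])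
    (hM₂ : (M₂ : Matrix (Fin 2) (Fin 2) ℂ) = !![0, Complex.I; Complex.I, 0])
    (hM₃ : (M₃ : Matrix (Fin 2) (Fin 2) ℂ) =
      !![(1 + Complex.I) / 2, (-1 + Complex.I) / 2;
         (1 + Complex.I) / 2, (1 - Complex.I) / 2]) :
    M₁ ∈ stabSubgroup (quartic t) ∧ M₂ ∈ stabSubgroup (quartic t) ∧
      M₃ ∈ stabSubgroup (quartic t) := by
  have hI := Complex.I_sq
  have hI4 := Complex.I_pow_four
  refine ⟨mem_Stab_quartic_iff.2 ⟨1, one_ne_zero, fun x y => ?_⟩,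
    mem_Stab_quartic_iff.2 ⟨1, one_ne_zero, fun x y => ?_⟩,
    mem_Stab_quartic_iff.2 ⟨-(1 + t) / 2, fun h => ?_, fun x y => ?_⟩⟩
  · simp only [hM₁, of_apply, cons_val', cons_val_zero, cons_val_one, cons_val_fin_one]
    linear_combination (x ^ 4 + 2 * t * x ^ 2 * y ^ 2 + y ^ 4) * hI4
  · simp only [hM₂, of_apply, cons_val', cons_val_zero, cons_val_one, cons_val_fin_one]
    linear_combination (x ^ 4 + 2 * t * x ^ 2 * y ^ 2 + y ^ 4) * hI4
  · have h1 : t = -1 := by linear_combination -2 * h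
    rw [h1] at ht
    norm_num at ht
  · simp only [hM₃, of_apply, cons_val', cons_val_zero, cons_val_one, cons_val_fin_one]
    have hu : ((1 + Complex.I) / 2 * x + (-1 + Complex.I) / 2 * y) ^ 2 =
        Complex.I / 2 * (x + Complex.I * y) ^ 2 := by
      linear_combination (x ^ 2 / 4 - x * y / 2 + y ^ 2 / 4 - Complex.I * y ^ 2 / 2) * hI
    have hv : ((1 + Complex.I) / 2 * x + (1 - Complex.I) / 2 * y) ^ 2 =
        Complex.I / 2 * (x - Complex.I * y) ^ 2 := by
      linear_combination (x ^ 2 / 4 + x * y / 2 + y ^ 2 / 4 - Complex.I * y ^ 2 / 2) * hI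
    have h4 (z : ℂ) : z ^ 4 = (z ^ 2) ^ 2 := by ring
    rw [h4 (_ + _), h4 (_ + _), hu, hv]
    linear_combination (x ^ 4 * (1 + t) / 2 + (3 - t) * x ^ 2 * y ^ 2 * (Complex.I ^ 2 - 1) +
      y ^ 4 * (1 + t) / 2 * (Complex.I ^ 4 - Complex.I ^ 2 + 1)) * hI + x ^ 2 * y ^ 2 * ht

/-- Every element of the stabilizer is a word `M₃ᵏ M₂ʲ M₁ⁱ`. -/
lemma exists_word_of_mem_Stab {t : ℂ} (ht : t ^ 2 = -3)
    (hM₁ : (M₁ : Matrix (Fin 2) (Fin 2) ℂ) = !![Complex.I, 0; 0, -Complex.I])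
    (hM₂ : (M₂ : Matrix (Fin 2) (Fin 2) ℂ) = !![0, Complex.I; Complex.I, 0])
    (hM₃ : (M₃ : Matrix (Fin 2) (Fin 2) ℂ) =
      !![(1 + Complex.I) / 2, (-1 + Complex.I) / 2;
         (1 + Complex.I) / 2, (1 - Complex.I) / 2])
    {A : SpecialLinearGroup (Fin 2) ℂ} (hA : A ∈ stabSubgroup (quartic t)) :
    ∃ w : Fin 3 × Fin 2 × Fin 4,
      M₃ ^ (w.1 : ℕ) * M₂ ^ (w.2.1 : ℕ) * M₁ ^ (w.2.2 : ℕ) = A := by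
  obtain ⟨-, hS₂, hS₃⟩ := generators_mem_stabSubgroup ht hM₁ hM₂ hM₃
  have hI := Complex.I_sq
  have of_zero {B : SpecialLinearGroup (Fin 2) ℂ} (hB : B ∈ stabSubgroup (quartic t))
      (h : B 0 0 * B 1 0 = 0) :
      ∃ (j : Fin 2) (i : Fin 4), M₂ ^ (j : ℕ) * M₁ ^ (i : ℕ) = B := by
    rcases mul_eq_zero.1 h with h | h
    · obtain ⟨i, hi⟩ := eq_pow_of_mem_Stab ht hM₁ (mul_mem (inv_mem hS₂) hB) (by
        simp [Matrix.SpecialLinearGroup.coe_mul, Matrix.SpecialLinearGroup.coe_inv, adjugate_fin_two, hM₂,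
          Matrix.mul_apply, Fin.sum_univ_two, h])
      exact ⟨1, i, by simp [← hi]⟩
    · obtain ⟨i, hi⟩ := eq_pow_of_mem_Stab ht hM₁ hB h
      exact ⟨0, i, by simp [← hi]⟩
  have of_power (k : Fin 3)
      (h : ((M₃ ^ (k : ℕ))⁻¹ * A) 0 0 * ((M₃ ^ (k : ℕ))⁻¹ * A) 1 0 = 0) :
      ∃ w : Fin 3 × Fin 2 × Fin 4,
        M₃ ^ (w.1 : ℕ) * M₂ ^ (w.2.1 : ℕ) * M₁ ^ (w.2.2 : ℕ) = A := by
    obtain ⟨j, i, hji⟩ := of_zero (mul_mem (inv_mem (pow_mem hS₃ (k : ℕ))) hA) h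
    exact ⟨(k, j, i), by simp [mul_assoc, hji]⟩
  obtain ⟨c, -, h⟩ := mem_Stab_quartic_iff.1 hA
  obtain ⟨-, h₁, -, h₃, -⟩ := quartic_coeffs h
  have hdet := A.det_coe
  rw [det_fin_two] at hdet
  have hcov := sextic_covariant_eq_zero ht hdet h₁ h₃
  rcases mul_eq_zero.1 hcov with h | h
  · exact of_power 0 (by simpa using h)
  have hfac : (A 0 0 ^ 2 - A 1 0 ^ 2) * (A 0 0 ^ 2 + A 1 0 ^ 2) = 0 := by
    linear_combination h
  rcases mul_eq_zero.1 hfac with h | h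
  · refine of_power 1 ?_
    simp [Matrix.SpecialLinearGroup.coe_mul, Matrix.SpecialLinearGroup.coe_inv, adjugate_fin_two, hM₃,
      Matrix.mul_apply, Fin.sum_univ_two, -mul_eq_zero]
    linear_combination (A 0 0 ^ 2 - A 1 0 ^ 2) / 4 * hI - h / 2
  · refine of_power 2 ?_
    simp [Matrix.SpecialLinearGroup.coe_mul, Matrix.SpecialLinearGroup.coe_inv, adjugate_fin_two, hM₃, pow_two,
      Matrix.mul_apply, Fin.sum_univ_two, -mul_eq_zero]
    linear_combination (Complex.I - Complex.I ^ 3) / 4 * h +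
      A 0 0 * A 1 0 / 4 * (Complex.I ^ 2 - 1) * hI

end Generators

/-- The stabilizer of `x⁴ + 2√-3 x²y² + y⁴` in `SL(2,ℂ)` is the binary
tetrahedral group `T` of order 24, generated by `diag(i,-i)`, `[[0,i],[i,0]]`
and `(1/2)[[1+i,-1+i],[1+i,1-i]]`. -/
theorem stab_quartic_tetrahedral
    (s3 : ℂ) (hs3 : s3 ^ 2 = -3)
    (M₁ M₂ M₃ : SpecialLinearGroup (Fin 2) ℂ)
    (hM₁ : (M₁ : Matrix (Fin 2) (Fin 2) ℂ) = !![Complex.I, 0; 0, -Complex.I])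
    (hM₂ : (M₂ : Matrix (Fin 2) (Fin 2) ℂ) = !![0, Complex.I; Complex.I, 0])
    (hM₃ : (M₃ : Matrix (Fin 2) (Fin 2) ℂ) =
      !![(1 + Complex.I) / 2, (-1 + Complex.I) / 2;
         (1 + Complex.I) / 2, (1 - Complex.I) / 2]) :
    Stab (Px ^ 4 + C (2 * s3) * Px ^ 2 * Py ^ 2 + Py ^ 4) =
      ↑(Subgroup.closure {M₁, M₂, M₃}) ∧
    Nat.card (Subgroup.closure {M₁, M₂, M₃} :
      Subgroup (SpecialLinearGroup (Fin 2) ℂ)) = 24 := by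
  obtain ⟨hS₁, hS₂, hS₃⟩ := generators_mem_stabSubgroup hs3 hM₁ hM₂ hM₃
  set T := Subgroup.closure {M₁, M₂, M₃}
  have hword (w : Fin 3 × Fin 2 × Fin 4) :
      M₃ ^ (w.1 : ℕ) * M₂ ^ (w.2.1 : ℕ) * M₁ ^ (w.2.2 : ℕ) ∈ T :=
    mul_mem (mul_mem (pow_mem (Subgroup.subset_closure (by simp)) _)
      (pow_mem (Subgroup.subset_closure (by simp)) _))
      (pow_mem (Subgroup.subset_closure (by simp)) _)
  have heq : stabSubgroup (quartic s3) = T := by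
    refine le_antisymm (fun A hA => ?_) ((Subgroup.closure_le _).2 ?_)
    · obtain ⟨w, rfl⟩ := exists_word_of_mem_Stab hs3 hM₁ hM₂ hM₃ hA
      exact hword w
    · rintro _ (rfl | rfl | rfl)
      exacts [hS₁, hS₂, hS₃]
  refine ⟨congrArg SetLike.coe heq, ?_⟩
  have hbij : Function.Bijective fun w : Fin 3 × Fin 2 × Fin 4 => (⟨_, hword w⟩ : T) := by
    refine ⟨fun w w' h => word_injective hM₁ hM₂ hM₃ (congrArg Subtype.val h), fun A => ?_⟩
    obtain ⟨w, hw⟩ := exists_word_of_mem_Stab hs3 hM₁ hM₂ hM₃ (heq.ge A.2)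
    exact ⟨w, Subtype.ext hw⟩
  rw [← Nat.card_congr (Equiv.ofBijective _ hbij)]
  simp

end
end

section
/- Let ε ∈ ℂ be a primitive 8th root of unity. The stabilizer Stab(x(x⁴+y⁴)) ⊂ SL(2,ℂ) equals the cyclic subgroup generated by diag(ε, ε⁻¹) (the group C₄, of order 8). -/
open MvPolynomial Matrix

noncomputable section

/-- A polynomial expression of degree at most five that vanishes identically has zero
coefficients. -/
lemma coeffs_eq_zero_of_quintic_eq_zero {a₀ a₁ a₂ a₃ a₄ a₅ : ℂ}
    (h : ∀ x y : ℂ, a₀ * x ^ 5 + a₁ * x ^ 4 * y + a₂ * x ^ 3 * y ^ 2 + a₃ * x ^ 2 * y ^ 3 +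
      a₄ * x * y ^ 4 + a₅ * y ^ 5 = 0) :
    a₀ = 0 ∧ a₁ = 0 ∧ a₂ = 0 ∧ a₃ = 0 ∧ a₄ = 0 ∧ a₅ = 0 := by
  have h₀ : a₀ = 0 := by linear_combination h 1 0
  have h₅ : a₅ = 0 := by linear_combination h 0 1
  subst h₀ h₅
  have h₄ : a₄ = 0 := by
    linear_combination (h 1 2 + h 1 (-2)) / 24 - (h 1 1 + h 1 (-1)) / 6
  have h₃ : a₃ = 0 := by
    linear_combination (h 1 2 - h 1 (-2)) / 12 - (h 1 1 - h 1 (-1)) / 6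
  subst h₄ h₃
  refine ⟨rfl, ?_, ?_, rfl, rfl, rfl⟩
  · linear_combination (h 1 1 - h 1 (-1)) / 2
  · linear_combination (h 1 1 + h 1 (-1)) / 2

/-- The system of coefficient equations expressing that a unimodular matrix preserves
`x (x⁴ + y⁴)` up to a scalar has only diagonal solutions. -/
lemma diagonal_of_coeff_equations {p q r s c : ℂ} (hdet : p * s - q * r = 1)
    (h₀ : p * (p ^ 4 + r ^ 4) = c)
    (h₁ : 5 * p ^ 4 * q + q * r ^ 4 + 4 * p * r ^ 3 * s = 0)
    (h₂ : 10 * p ^ 3 * q ^ 2 + 4 * q * r ^ 3 * s + 6 * p * r ^ 2 * s ^ 2 = 0)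
    (h₃ : 10 * p ^ 2 * q ^ 3 + 6 * q * r ^ 2 * s ^ 2 + 4 * p * r * s ^ 3 = 0)
    (h₄ : 5 * p * q ^ 4 + 4 * q * r * s ^ 3 + p * s ^ 4 = c)
    (h₅ : q * (q ^ 4 + s ^ 4) = 0) :
    q = 0 ∧ r = 0 ∧ p ^ 8 = 1 := by
  by_cases hq : q = 0
  · subst hq
    have hps : p * s = 1 := by linear_combination hdet
    have hr : r = 0 := by
      have : r ^ 3 = 0 := by linear_combination h₁ / 4 - r ^ 3 * hps
      simpa using this
    subst hr
    have hp : p ≠ 0 := left_ne_zero_of_mul_eq_one hps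
    have h : p ^ 4 = s ^ 4 := mul_left_cancel₀ hp (by linear_combination h₀ - h₄)
    refine ⟨rfl, rfl, ?_⟩
    calc p ^ 8 = (p * s) ^ 4 := by linear_combination p ^ 4 * h
      _ = 1 := by rw [hps, one_pow]
  · exfalso
    obtain ⟨t, rfl⟩ : ∃ t, s = t * q := ⟨s / q, (div_mul_cancel₀ s hq).symm⟩
    have ht : t ^ 4 = -1 :=
      mul_left_cancel₀ (pow_ne_zero 5 hq) (by linear_combination h₅)
    have ht0 : t ≠ 0 := by rintro rfl; norm_num at ht
    have e₂ : 10 * p ^ 3 + 4 * r ^ 3 * t + 6 * p * r ^ 2 * t ^ 2 = 0 :=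
      mul_left_cancel₀ (pow_ne_zero 2 hq) (by linear_combination h₂)
    have e₃ : 10 * p ^ 2 + 6 * r ^ 2 * t ^ 2 + 4 * p * r * t ^ 3 = 0 :=
      mul_left_cancel₀ (pow_ne_zero 3 hq) (by linear_combination h₃)
    have hd : r - p * t ≠ 0 := by
      intro h
      exact one_ne_zero (by linear_combination -hdet - q * h : (1 : ℂ) = 0)
    have key : r * (r + p * t) = 0 :=
      mul_left_cancel₀ (mul_ne_zero ht0 hd) (by linear_combination (e₂ - p * e₃) / 4)
    have hp : p = 0 := by
      rcases mul_eq_zero.mp key with hr | hr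
      · have : p ^ 2 = 0 := by
          rw [hr] at e₃
          linear_combination e₃ / 10
        simpa using this
      · have : p ^ 2 = 0 := by
          rw [eq_neg_of_add_eq_zero_left hr] at e₃
          linear_combination e₃ / 8 - p ^ 2 / 4 * ht
        simpa using this
    subst hp
    have hr : r = 0 := by simpa using key
    simp [hr] at hdet

lemma matAct_quintic (A : Matrix (Fin 2) (Fin 2) ℂ) :
    matAct A (Px * (Px ^ 4 + Py ^ 4)) =
      (C (A 0 0) * Px + C (A 0 1) * Py) *
        ((C (A 0 0) * Px + C (A 0 1) * Py) ^ 4 + (C (A 1 0) * Px + C (A 1 1) * Py) ^ 4) := by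
  simp [matAct, Px, Py]

/-- A unimodular matrix stabilizes `x (x⁴ + y⁴)` iff it is diagonal with an eighth root of
unity in the upper left corner. -/
lemma mem_stab_quintic_iff (A : SpecialLinearGroup (Fin 2) ℂ) :
    A ∈ Stab (Px * (Px ^ 4 + Py ^ 4)) ↔ A 0 1 = 0 ∧ A 1 0 = 0 ∧ A 0 0 ^ 8 = 1 := by
  have hdet : A 0 0 * A 1 1 - A 0 1 * A 1 0 = 1 := by
    rw [← Matrix.det_fin_two]
    exact A.det_coe
  constructor
  · rintro ⟨c, -, hc⟩
    rw [matAct_quintic] at hc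
    have hev (x y : ℂ) := congrArg (MvPolynomial.eval ![x, y]) hc
    simp only [Px, Py, map_mul, map_add, map_pow, eval_C, eval_X, cons_val_zero,
      cons_val_one] at hev
    generalize A 0 0 = p at *
    generalize A 0 1 = q at *
    generalize A 1 0 = r at *
    generalize A 1 1 = s at *
    obtain ⟨h₀, h₁, h₂, h₃, h₄, h₅⟩ := coeffs_eq_zero_of_quintic_eq_zero
      (a₀ := p * (p ^ 4 + r ^ 4) - c)
      (a₁ := 5 * p ^ 4 * q + q * r ^ 4 + 4 * p * r ^ 3 * s)
      (a₂ := 10 * p ^ 3 * q ^ 2 + 4 * q * r ^ 3 * s + 6 * p * r ^ 2 * s ^ 2)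
      (a₃ := 10 * p ^ 2 * q ^ 3 + 6 * q * r ^ 2 * s ^ 2 + 4 * p * r * s ^ 3)
      (a₄ := 5 * p * q ^ 4 + 4 * q * r * s ^ 3 + p * s ^ 4 - c)
      (a₅ := q * (q ^ 4 + s ^ 4))
      (fun x y => by linear_combination hev x y)
    exact diagonal_of_coeff_equations hdet (sub_eq_zero.mp h₀) h₁ h₂ h₃ (sub_eq_zero.mp h₄) h₅
  · rintro ⟨hq, hr, hp⟩
    have hps : A 0 0 * A 1 1 = 1 := by linear_combination hdet + A 1 0 * hq
    have hs : A 1 1 ^ 4 = A 0 0 ^ 4 := by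
      linear_combination A 0 0 ^ 4 * (congrArg (· ^ 4) hps) - A 1 1 ^ 4 * hp
    refine ⟨A 0 0 ^ 5, pow_ne_zero 5 (left_ne_zero_of_mul_eq_one hps), ?_⟩
    have hsC : (C (A 1 1) : BPoly) ^ 4 = C (A 0 0) ^ 4 := by rw [← C_pow, hs, C_pow]
    rw [matAct_quintic, hq, hr, C_0, C_pow]
    linear_combination C (A 0 0) * Px * Py ^ 4 * hsC

lemma coe_pow_of_coe_eq_diagonal {ε : ℂ} {D : SpecialLinearGroup (Fin 2) ℂ}
    (hD : (D : Matrix (Fin 2) (Fin 2) ℂ) = !![ε, 0; 0, ε⁻¹]) (n : ℕ) :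
    ((D ^ n : SpecialLinearGroup (Fin 2) ℂ) : Matrix (Fin 2) (Fin 2) ℂ) =
      !![ε ^ n, 0; 0, ε⁻¹ ^ n] := by
  induction n with
  | zero => simp [Matrix.one_fin_two]
  | succ n ih =>
    rw [pow_succ]
    refine (Matrix.SpecialLinearGroup.coe_mul (D ^ n) D).trans ?_
    rw [ih, hD]
    simp [pow_succ]

lemma orderOf_of_coe_eq_diagonal {ε : ℂ} {k : ℕ} (hε : IsPrimitiveRoot ε k)
    {D : SpecialLinearGroup (Fin 2) ℂ}
    (hD : (D : Matrix (Fin 2) (Fin 2) ℂ) = !![ε, 0; 0, ε⁻¹]) : orderOf D = k := by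
  rw [hε.eq_orderOf]
  refine orderOf_eq_orderOf_iff.mpr fun n => ⟨fun h => ?_, fun h => ?_⟩
  · have := coe_pow_of_coe_eq_diagonal hD n
    rw [h] at this
    simpa using (congrFun (congrFun this 0) 0).symm
  · apply Subtype.ext
    rw [coe_pow_of_coe_eq_diagonal hD, inv_pow, h]
    simp [Matrix.one_fin_two]

/-- The stabilizer of `x(x⁴+y⁴)` in `SL(2,ℂ)` is the cyclic group `C₄` of
order 8, generated by `diag(ε, ε⁻¹)` (`ε` a primitive 8th root of unity). -/
theorem stab_quintic_cyclic
    (ε : ℂ) (hε : IsPrimitiveRoot ε 8)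
    (D : SpecialLinearGroup (Fin 2) ℂ)
    (hD : (D : Matrix (Fin 2) (Fin 2) ℂ) = !![ε, 0; 0, ε⁻¹]) :
    Stab (Px * (Px ^ 4 + Py ^ 4)) = ↑(Subgroup.closure {D}) ∧
    Nat.card (Subgroup.closure {D} : Subgroup (SpecialLinearGroup (Fin 2) ℂ)) = 8 := by
  have hord : orderOf D = 8 := orderOf_of_coe_eq_diagonal hε hD
  rw [← Subgroup.zpowers_eq_closure]
  refine ⟨?_, by rw [Nat.card_zpowers, hord]⟩
  have hfin : IsOfFinOrder D := orderOf_pos_iff.mp (by simp [hord])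
  ext A
  rw [mem_stab_quintic_iff, SetLike.mem_coe, ← hfin.mem_powers_iff_mem_zpowers,
    Submonoid.mem_powers_iff]
  constructor
  · rintro ⟨hq, hr, hp⟩
    obtain ⟨n, -, hn⟩ := hε.eq_pow_of_pow_eq_one hp
    have hdet : A 0 0 * A 1 1 - A 0 1 * A 1 0 = 1 := by
      rw [← Matrix.det_fin_two]
      exact A.det_coe
    have hs : A 1 1 = ε⁻¹ ^ n := by
      rw [inv_pow, hn]
      exact eq_inv_of_mul_eq_one_right (by linear_combination hdet + A 1 0 * hq)
    refine ⟨n, Subtype.ext ?_⟩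
    rw [coe_pow_of_coe_eq_diagonal hD, hn, ← hs, Matrix.eta_fin_two A.val]
    simp [hq, hr]
  · rintro ⟨n, rfl⟩
    rw [coe_pow_of_coe_eq_diagonal hD]
    refine ⟨by simp, by simp, ?_⟩
    simp [pow_right_comm ε n 8, hε.pow_eq_one]

end
end

section
/- The stabilizer Stab(xy(x⁴−y⁴)) ⊂ SL(2,ℂ) equals the subgroup generated by diag(i,−i), [[0,i],[i,0]], (1/2)[[1+i, −1+i],[1+i, 1−i]], and (1/√2)[[1+i, 0],[0, 1−i]] (the binary octahedral group O, of order 48). -/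
open MvPolynomial Matrix

noncomputable section

/-- The values of the binary form `xy(x⁴-y⁴)`. -/
def sexticVal (a b : ℂ) : ℂ := a * b * (a ^ 4 - b ^ 4)

lemma mem_stab_sextic_iff (A : SpecialLinearGroup (Fin 2) ℂ) :
    A ∈ Stab (Px * Py * (Px ^ 4 - Py ^ 4)) ↔ ∃ c : ℂ, c ≠ 0 ∧ ∀ a b : ℂ,
      sexticVal (A 0 0 * a + A 0 1 * b) (A 1 0 * a + A 1 1 * b) = c * sexticVal a b := by
  refine exists_congr fun c => and_congr_right fun _ => ⟨fun h a b => ?_, fun h => ?_⟩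
  · simpa [matAct, Px, Py, sexticVal] using congrArg (eval ![a, b]) h
  · refine MvPolynomial.funext fun z => ?_
    simpa [matAct, Px, Py, sexticVal] using h (z 0) (z 1)

lemma mul_apply_fin_two (A B : SpecialLinearGroup (Fin 2) ℂ) (i j : Fin 2) :
    (A * B) i j = A i 0 * B 0 j + A i 1 * B 1 j := by
  simp [Matrix.mul_apply, Fin.sum_univ_two]

lemma inv_apply_fin_two (A : SpecialLinearGroup (Fin 2) ℂ) :
    A⁻¹ 0 0 = A 1 1 ∧ A⁻¹ 0 1 = -A 0 1 ∧ A⁻¹ 1 0 = -A 1 0 ∧ A⁻¹ 1 1 = A 0 0 := by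
  simp [Matrix.adjugate_fin_two]

/-- The stabilizer of `xy(x⁴-y⁴)` as a subgroup. -/
def sexticStab : Subgroup (SpecialLinearGroup (Fin 2) ℂ) where
  carrier := Stab (Px * Py * (Px ^ 4 - Py ^ 4))
  one_mem' := (mem_stab_sextic_iff 1).2 ⟨1, one_ne_zero, fun a b => by simp⟩
  mul_mem' := by
    intro A B hA hB
    obtain ⟨c, hc, hA⟩ := (mem_stab_sextic_iff A).1 hA
    obtain ⟨d, hd, hB⟩ := (mem_stab_sextic_iff B).1 hB
    refine (mem_stab_sextic_iff _).2 ⟨c * d, mul_ne_zero hc hd, fun a b => ?_⟩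
    rw [mul_assoc, ← hB, ← hA]
    simp only [mul_apply_fin_two]
    congr 1 <;> ring
  inv_mem' := by
    intro A hA
    obtain ⟨c, hc, hA⟩ := (mem_stab_sextic_iff A).1 hA
    refine (mem_stab_sextic_iff _).2 ⟨c⁻¹, inv_ne_zero hc, fun a b => ?_⟩
    rw [eq_inv_mul_iff_mul_eq₀ hc, ← hA]
    have hdet : A 0 0 * A 1 1 - A 0 1 * A 1 0 = 1 := by
      rw [← Matrix.det_fin_two]; exact A.det_coe
    obtain ⟨h00, h01, h10, h11⟩ := inv_apply_fin_two A
    rw [h00, h01, h10, h11]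
    congr 1
    · linear_combination a * hdet
    · linear_combination b * hdet

lemma sextic_root_of_mem {A : SpecialLinearGroup (Fin 2) ℂ} (hA : A ∈ sexticStab) :
    sexticVal (A 0 0) (A 1 0) = 0 := by
  obtain ⟨c, -, hA⟩ := (mem_stab_sextic_iff A).1 hA
  simpa [sexticVal] using hA 1 0

/-- An upper triangular element of the stabilizer is diagonal, with entries eighth roots of
unity. -/
lemma diagonal_of_mem_of_lower_zero {A : SpecialLinearGroup (Fin 2) ℂ} (hA : A ∈ sexticStab)
    (h10 : A 1 0 = 0) : A 0 1 = 0 ∧ A 0 0 ^ 8 = 1 ∧ A 0 0 * A 1 1 = 1 := by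
  obtain ⟨c, -, hA⟩ := (mem_stab_sextic_iff A).1 hA
  have hdet : A 0 0 * A 1 1 - A 0 1 * A 1 0 = 1 := by
    rw [← Matrix.det_fin_two]; exact A.det_coe
  simp only [h10, mul_zero, sub_zero, zero_mul, zero_add, sexticVal] at hA hdet
  generalize A 0 0 = p at *
  generalize A 0 1 = q at *
  generalize A 1 1 = s at *
  have hI : Complex.I ^ 2 = -1 := Complex.I_sq
  have hp : p ≠ 0 := left_ne_zero_of_mul_eq_one hdet
  have hs : s ≠ 0 := right_ne_zero_of_mul_eq_one hdet
  have h0 := hA 0 1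
  have h1 := hA 1 1
  have h2 := hA (-1) 1
  have h3 := hA Complex.I 1
  have h4 := hA (-Complex.I) 1
  have hq : 20 * p ^ 4 * s * q = 0 := by
    linear_combination h1 + h2 + h3 + h4 - 4 * h0 +
      (10 * p ^ 4 * q * s * (1 - Complex.I ^ 2) - 20 * p ^ 2 * q ^ 3 * s) * hI
  have hq0 : q = 0 := by simpa [hp, hs] using hq
  subst hq0
  have h : p ^ 4 = s ^ 4 := by
    have : p * s * (p ^ 4 - s ^ 4) = 0 := by linear_combination h1
    rw [hdet, one_mul] at this
    exact sub_eq_zero.1 this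
  refine ⟨rfl, ?_, hdet⟩
  calc p ^ 8 = p ^ 4 * p ^ 4 := by ring
    _ = (p * s) ^ 4 := by nth_rewrite 2 [h]; ring
    _ = 1 := by rw [hdet, one_pow]

lemma isPrimitiveRoot_eight {w : ℂ} (hw : w ^ 2 = Complex.I) : IsPrimitiveRoot w 8 := by
  have h4 : w ^ 4 = -1 := by
    rw [show (4 : ℕ) = 2 * 2 from rfl, pow_mul, hw, Complex.I_sq]
  rw [IsPrimitiveRoot.iff_orderOf]
  refine orderOf_eq_prime_pow (p := 2) (n := 2) ?_ ?_
  · norm_num [h4]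
  · rw [show 2 ^ (2 + 1) = 4 * 2 from rfl, pow_mul, h4]; norm_num

lemma coe_pow_of_diagonal {D : SpecialLinearGroup (Fin 2) ℂ} {w v : ℂ}
    (hD : (D : Matrix (Fin 2) (Fin 2) ℂ) = !![w, 0; 0, v]) (k : ℕ) :
    ((D ^ k : SpecialLinearGroup (Fin 2) ℂ) : Matrix (Fin 2) (Fin 2) ℂ) =
      !![w ^ k, 0; 0, v ^ k] := by
  induction k with
  | zero => simp [Matrix.one_fin_two]
  | succ k ih => simp [pow_succ, ih, hD]

lemma eq_pow_of_mem_of_lower_zero {A D : SpecialLinearGroup (Fin 2) ℂ} {w v : ℂ}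
    (hw : w ^ 2 = Complex.I) (hwv : w * v = 1)
    (hD : (D : Matrix (Fin 2) (Fin 2) ℂ) = !![w, 0; 0, v])
    (hA : A ∈ sexticStab) (h10 : A 1 0 = 0) : ∃ k : Fin 8, A = D ^ (k : ℕ) := by
  obtain ⟨h01, h8, hdet⟩ := diagonal_of_mem_of_lower_zero hA h10
  obtain ⟨k, hk, hpk⟩ := (isPrimitiveRoot_eight hw).eq_pow_of_pow_eq_one h8
  refine ⟨⟨k, hk⟩, Subtype.ext ?_⟩
  have h11 : A 1 1 = v ^ k := by
    apply mul_left_cancel₀ (left_ne_zero_of_mul_eq_one hdet)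
    rw [hdet, ← hpk, ← mul_pow, hwv, one_pow]
  rw [coe_pow_of_diagonal hD, Matrix.eta_fin_two (A : Matrix (Fin 2) (Fin 2) ℂ)]
  simp [h10, h01, h11, hpk]

/-- Coset representatives of the diagonal subgroup generated by `D` in the stabilizer. -/
def octahedralRep (S T D : SpecialLinearGroup (Fin 2) ℂ) :
    Fin 6 → SpecialLinearGroup (Fin 2) ℂ :=
  ![1, S, T, D * T, D ^ 2 * T, D ^ 3 * T]

section

variable {S T D : SpecialLinearGroup (Fin 2) ℂ} {w v : ℂ}

lemma octahedralRep_mem {H : Subgroup (SpecialLinearGroup (Fin 2) ℂ)} (hS : S ∈ H) (hT : T ∈ H)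
    (hD : D ∈ H) (j : Fin 6) : octahedralRep S T D j ∈ H := by
  fin_cases j
  exacts [H.one_mem, hS, hT, H.mul_mem hD hT, H.mul_mem (H.pow_mem hD 2) hT,
    H.mul_mem (H.pow_mem hD 3) hT]

/-- The first columns of the representatives are proportional to these six vectors. -/
def octahedralVertex : Fin 6 → ℂ × ℂ :=
  ![(1, 0), (0, 1), (1, 1), (Complex.I, 1), (-1, 1), (-Complex.I, 1)]

lemma octahedralRep_column (hw : w ^ 2 = Complex.I) (hwv : w * v = 1)
    (hS : (S : Matrix (Fin 2) (Fin 2) ℂ) = !![0, Complex.I; Complex.I, 0])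
    (hT : (T : Matrix (Fin 2) (Fin 2) ℂ) =
      !![(1 + Complex.I) / 2, (-1 + Complex.I) / 2;
         (1 + Complex.I) / 2, (1 - Complex.I) / 2])
    (hD : (D : Matrix (Fin 2) (Fin 2) ℂ) = !![w, 0; 0, v]) (j : Fin 6) :
    ∃ t : ℂ, t ≠ 0 ∧ octahedralRep S T D j 0 0 = t * (octahedralVertex j).1 ∧
      octahedralRep S T D j 1 0 = t * (octahedralVertex j).2 := by
  have hI : Complex.I ^ 2 = -1 := Complex.I_sq
  have hu : (1 + Complex.I) / 2 ≠ 0 := by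
    intro h; simpa using congrArg Complex.re h
  have hv : v ≠ 0 := right_ne_zero_of_mul_eq_one hwv
  have hwIv : w = Complex.I * v := by linear_combination v * hw - w * hwv
  have hD2 := coe_pow_of_diagonal hD 2
  have hD3 := coe_pow_of_diagonal hD 3
  fin_cases j
  · exact ⟨1, one_ne_zero, by simp [octahedralRep, octahedralVertex]⟩
  · exact ⟨Complex.I, Complex.I_ne_zero, by simp [octahedralRep, octahedralVertex, hS]⟩
  · exact ⟨(1 + Complex.I) / 2, hu, by simp [octahedralRep, octahedralVertex, hT]⟩
  · refine ⟨v * ((1 + Complex.I) / 2), mul_ne_zero hv hu, ?_⟩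
    simp [octahedralRep, octahedralVertex, hT, hD]
    rw [hwIv]; ring
  · refine ⟨v ^ 2 * ((1 + Complex.I) / 2), mul_ne_zero (pow_ne_zero 2 hv) hu, ?_⟩
    simp [octahedralRep, octahedralVertex, hT, hD2]
    rw [hwIv, mul_pow, hI]; ring
  · refine ⟨v ^ 3 * ((1 + Complex.I) / 2), mul_ne_zero (pow_ne_zero 3 hv) hu, ?_⟩
    simp [octahedralRep, octahedralVertex, hT, hD3]
    rw [hwIv, mul_pow, Complex.I_pow_three]; ring

lemma octahedralVertex_injective {i j : Fin 6}
    (h : (octahedralVertex i).1 * (octahedralVertex j).2 =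
      (octahedralVertex j).1 * (octahedralVertex i).2) : i = j := by
  fin_cases i <;> fin_cases j <;> first
    | rfl
    | (exfalso; norm_num [octahedralVertex, Complex.ext_iff] at h)

lemma exists_octahedralVertex_of_root {p r : ℂ} (h : sexticVal p r = 0) :
    ∃ j, (octahedralVertex j).1 * r = (octahedralVertex j).2 * p := by
  have hI : Complex.I ^ 2 = -1 := Complex.I_sq
  have h' : r * (p * ((p - r) * ((p - Complex.I * r) * ((p + r) * (p + Complex.I * r))))) = 0 := by
    rw [sexticVal] at h
    linear_combination h - p * r * (p ^ 2 - r ^ 2) * r ^ 2 * hI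
  simp only [mul_eq_zero] at h'
  rcases h' with h' | h' | h' | h' | h' | h'
  · exact ⟨0, by simp [octahedralVertex, h']⟩
  · exact ⟨1, by simp [octahedralVertex, h']⟩
  · exact ⟨2, by simp [octahedralVertex]; linear_combination -h'⟩
  · exact ⟨3, by simp [octahedralVertex]; linear_combination -h'⟩
  · exact ⟨4, by simp [octahedralVertex]; linear_combination -h'⟩
  · exact ⟨5, by simp [octahedralVertex]; linear_combination -h'⟩

lemma exists_eq_octahedralRep_mul_pow (hw : w ^ 2 = Complex.I) (hwv : w * v = 1)
    (hS : (S : Matrix (Fin 2) (Fin 2) ℂ) = !![0, Complex.I; Complex.I, 0])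
    (hT : (T : Matrix (Fin 2) (Fin 2) ℂ) =
      !![(1 + Complex.I) / 2, (-1 + Complex.I) / 2;
         (1 + Complex.I) / 2, (1 - Complex.I) / 2])
    (hD : (D : Matrix (Fin 2) (Fin 2) ℂ) = !![w, 0; 0, v])
    (hSm : S ∈ sexticStab) (hTm : T ∈ sexticStab) (hDm : D ∈ sexticStab)
    {A : SpecialLinearGroup (Fin 2) ℂ} (hA : A ∈ sexticStab) :
    ∃ (j : Fin 6) (k : Fin 8), A = octahedralRep S T D j * D ^ (k : ℕ) := by
  obtain ⟨j, hj⟩ := exists_octahedralVertex_of_root (sextic_root_of_mem hA)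
  obtain ⟨t, -, h0, h1⟩ := octahedralRep_column hw hwv hS hT hD j
  have hmem := sexticStab.mul_mem (sexticStab.inv_mem (octahedralRep_mem hSm hTm hDm j)) hA
  obtain ⟨k, hk⟩ := eq_pow_of_mem_of_lower_zero hw hwv hD hmem (by
    obtain ⟨-, -, h10, h11⟩ := inv_apply_fin_two (octahedralRep S T D j)
    rw [mul_apply_fin_two, h10, h11, h0, h1]
    linear_combination t * hj)
  exact ⟨j, k, by rw [← hk, mul_inv_cancel_left]⟩

lemma octahedralRep_mul_pow_injective (hw : w ^ 2 = Complex.I) (hwv : w * v = 1)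
    (hS : (S : Matrix (Fin 2) (Fin 2) ℂ) = !![0, Complex.I; Complex.I, 0])
    (hT : (T : Matrix (Fin 2) (Fin 2) ℂ) =
      !![(1 + Complex.I) / 2, (-1 + Complex.I) / 2;
         (1 + Complex.I) / 2, (1 - Complex.I) / 2])
    (hD : (D : Matrix (Fin 2) (Fin 2) ℂ) = !![w, 0; 0, v]) :
    Function.Injective fun x : Fin 6 × Fin 8 => octahedralRep S T D x.1 * D ^ (x.2 : ℕ) := by
  rintro ⟨i, k⟩ ⟨j, l⟩ h
  dsimp only at h
  have hij : i = j := by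
    obtain ⟨t, ht, ht0, ht1⟩ := octahedralRep_column hw hwv hS hT hD i
    obtain ⟨u, hu, hu0, hu1⟩ := octahedralRep_column hw hwv hS hT hD j
    have hw0 : w ≠ 0 := left_ne_zero_of_mul_eq_one hwv
    have hcol (m : Fin 2) :
        octahedralRep S T D i m 0 * w ^ (k : ℕ) = octahedralRep S T D j m 0 * w ^ (l : ℕ) := by
      have := congrArg (fun A : SpecialLinearGroup (Fin 2) ℂ => A m 0) h
      simpa [SpecialLinearGroup.coe_mul, Matrix.mul_apply, Fin.sum_univ_two,
        coe_pow_of_diagonal hD, -SpecialLinearGroup.coe_pow] using this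
    have e0 := hcol 0
    have e1 := hcol 1
    rw [ht0, hu0] at e0
    rw [ht1, hu1] at e1
    refine octahedralVertex_injective
      (mul_left_cancel₀ (mul_ne_zero (mul_ne_zero ht hu)
        (mul_ne_zero (pow_ne_zero k hw0) (pow_ne_zero l hw0))) ?_)
    linear_combination (u * w ^ (l : ℕ) * (octahedralVertex j).2) * e0
      - (u * w ^ (l : ℕ) * (octahedralVertex j).1) * e1
  subst hij
  have h00 := congrArg (fun A : SpecialLinearGroup (Fin 2) ℂ => A 0 0) (mul_left_cancel h)
  simp only [coe_pow_of_diagonal hD] at h00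
  exact Prod.ext rfl (Fin.ext ((isPrimitiveRoot_eight hw).pow_inj k.2 l.2 (by simpa using h00)))

end

/-- The stabilizer of `xy(x⁴-y⁴)` in `SL(2,ℂ)` is the binary octahedral group
`O` of order 48, generated by `diag(i,-i)`, `[[0,i],[i,0]]`,
`(1/2)[[1+i,-1+i],[1+i,1-i]]` and `(1/√2)[[1+i,0],[0,1-i]]`. -/
theorem stab_sextic_octahedral
    (s2 : ℂ) (hs2 : s2 ^ 2 = 2)
    (M₁ M₂ M₃ M₄ : SpecialLinearGroup (Fin 2) ℂ)
    (hM₁ : (M₁ : Matrix (Fin 2) (Fin 2) ℂ) = !![Complex.I, 0; 0, -Complex.I])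
    (hM₂ : (M₂ : Matrix (Fin 2) (Fin 2) ℂ) = !![0, Complex.I; Complex.I, 0])
    (hM₃ : (M₃ : Matrix (Fin 2) (Fin 2) ℂ) =
      !![(1 + Complex.I) / 2, (-1 + Complex.I) / 2;
         (1 + Complex.I) / 2, (1 - Complex.I) / 2])
    (hM₄ : (M₄ : Matrix (Fin 2) (Fin 2) ℂ) =
      !![(1 + Complex.I) / s2, 0; 0, (1 - Complex.I) / s2]) :
    Stab (Px * Py * (Px ^ 4 - Py ^ 4)) = ↑(Subgroup.closure {M₁, M₂, M₃, M₄}) ∧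
    Nat.card (Subgroup.closure {M₁, M₂, M₃, M₄} :
      Subgroup (SpecialLinearGroup (Fin 2) ℂ)) = 48 := by
  set w : ℂ := (1 + Complex.I) / s2 with hwdef
  set v : ℂ := (1 - Complex.I) / s2 with hvdef
  have hI : Complex.I ^ 2 = -1 := Complex.I_sq
  have hw : w ^ 2 = Complex.I := by
    rw [hwdef, div_pow, hs2]; linear_combination hI / 2
  have hwv : w * v = 1 := by
    rw [hwdef, hvdef, div_mul_div_comm, ← sq, hs2]; linear_combination -hI / 2
  have hv : v ^ 2 = -Complex.I := by
    rw [hvdef, div_pow, hs2]; linear_combination hI / 2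
  have h₁ : M₁ ∈ sexticStab := (mem_stab_sextic_iff _).2 ⟨1, one_ne_zero, fun a b => by
    simp only [hM₁, sexticVal, Matrix.of_apply, Matrix.cons_val_zero, Matrix.cons_val_one,
      Matrix.cons_val']
    linear_combination (-a * b * (a ^ 4 - b ^ 4) * (Complex.I ^ 4 - Complex.I ^ 2 + 1)) * hI⟩
  have h₂ : M₂ ∈ sexticStab := (mem_stab_sextic_iff _).2 ⟨1, one_ne_zero, fun a b => by
    simp only [hM₂, sexticVal, Matrix.of_apply, Matrix.cons_val_zero, Matrix.cons_val_one,
      Matrix.cons_val']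
    linear_combination (-a * b * (a ^ 4 - b ^ 4) * (Complex.I ^ 4 - Complex.I ^ 2 + 1)) * hI⟩
  have h₃ : M₃ ∈ sexticStab := (mem_stab_sextic_iff _).2 ⟨1, one_ne_zero, fun a b => by
    have hI3 : Complex.I ^ 3 = -Complex.I := Complex.I_pow_three
    have hx : (1 + Complex.I) / 2 * a + (-1 + Complex.I) / 2 * b =
        (1 + Complex.I) / 2 * (a + Complex.I * b) := by linear_combination -b / 2 * hI
    have hy : (1 + Complex.I) / 2 * a + (1 - Complex.I) / 2 * b =
        (1 + Complex.I) / 2 * (a - Complex.I * b) := by linear_combination b / 2 * hI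
    have hu : ((1 + Complex.I) / 2) ^ 6 = -Complex.I / 8 := by
      rw [show ((1 + Complex.I) / 2) ^ 6 = ((1 + 2 * Complex.I + Complex.I ^ 2) / 4) ^ 3 by ring,
        hI]
      linear_combination hI3 / 8
    have hz : sexticVal (a + Complex.I * b) (a - Complex.I * b) =
        8 * Complex.I * sexticVal a b := by
      simp only [sexticVal]
      linear_combination (-8 * Complex.I * a * b ^ 5 * (Complex.I ^ 2 - 1)) * hI
    simp only [hM₃, Matrix.of_apply, Matrix.cons_val_zero, Matrix.cons_val_one, Matrix.cons_val']
    rw [hx, hy]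
    calc _ = ((1 + Complex.I) / 2) ^ 6 * sexticVal (a + Complex.I * b) (a - Complex.I * b) := by
          simp only [sexticVal]; ring
      _ = _ := by rw [hu, hz]; linear_combination -sexticVal a b * hI⟩
  have h₄ : M₄ ∈ sexticStab := (mem_stab_sextic_iff _).2 ⟨-1, by norm_num, fun a b => by
    have hw4 : w ^ 4 = -1 := by linear_combination (w ^ 2 + Complex.I) * hw + hI
    have hv4 : v ^ 4 = -1 := by linear_combination (v ^ 2 - Complex.I) * hv + hI
    simp only [hM₄, sexticVal, Matrix.of_apply, Matrix.cons_val_zero, Matrix.cons_val_one,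
      Matrix.cons_val', zero_mul, add_zero, zero_add, mul_pow, hw4, hv4]
    linear_combination (-a * b * (a ^ 4 - b ^ 4)) * hwv⟩
  have hclosure : Subgroup.closure {M₁, M₂, M₃, M₄} = sexticStab := by
    refine le_antisymm ((Subgroup.closure_le _).2 ?_) fun A hA => ?_
    · rintro A (rfl | rfl | rfl | rfl) <;> assumption
    · obtain ⟨j, k, rfl⟩ := exists_eq_octahedralRep_mul_pow hw hwv hM₂ hM₃ hM₄ h₂ h₃ h₄ hA
      exact Subgroup.mul_mem _ (octahedralRep_mem (Subgroup.subset_closure (by simp))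
        (Subgroup.subset_closure (by simp)) (Subgroup.subset_closure (by simp)) j)
        (Subgroup.pow_mem _ (Subgroup.subset_closure (by simp)) _)
  rw [hclosure]
  refine ⟨rfl, ?_⟩
  have hrange : (sexticStab : Set (SpecialLinearGroup (Fin 2) ℂ)) =
      Set.range fun x : Fin 6 × Fin 8 => octahedralRep M₂ M₃ M₄ x.1 * M₄ ^ (x.2 : ℕ) := by
    ext A
    constructor
    · intro hA
      obtain ⟨j, k, rfl⟩ := exists_eq_octahedralRep_mul_pow hw hwv hM₂ hM₃ hM₄ h₂ h₃ h₄ hA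
      exact ⟨(j, k), rfl⟩
    · rintro ⟨⟨j, k⟩, rfl⟩
      exact sexticStab.mul_mem (octahedralRep_mem h₂ h₃ h₄ j) (sexticStab.pow_mem h₄ _)
  change Nat.card (sexticStab : Set (SpecialLinearGroup (Fin 2) ℂ)) = 48
  rw [hrange, Nat.card_range_of_injective
    (octahedralRep_mul_pow_injective hw hwv hM₂ hM₃ hM₄)]
  simp

end
end

section
/- Let P ∈ ℂ[x,y,z] be the polynomial P = −9xy⁴ − 24y³z + 6x²y²z + 72xyz² + 144z³ − x³z² (so that 324·F(I₄,I₈,I₁₂) = P evaluated at the invariants of a binary quintic). Then: (a) P is irreducible in ℂ[x,y,z]; and (b) a point (a,b,c) ∈ ℂ³ \ {(0,0,0)} satisfies ∂P/∂x = ∂P/∂y = ∂P/∂z = 0 at (a,b,c) if and only if (a,b,c) = (t, 0, 0) or (a,b,c) = (−3t, 3t², 3t³) for some t ∈ ℂ \ {0}. In particular, the hypersurface Z(P) in the weighted projective plane ℙ(1,2,3) is singular precisely at the two points (1:0:0) and (−3:3:3). -/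
open MvPolynomial

noncomputable section

/-- The polynomial `P = -9xy⁴ - 24y³z + 6x²y²z + 72xyz² + 144z³ - x³z²`
expressing (up to the factor 324) the relation `I₁₈² = F(I₄,I₈,I₁₂)` among
Schur's invariants of binary quintics; here `x = X 0`, `y = X 1`, `z = X 2`. -/
def P : MvPolynomial (Fin 3) ℂ :=
  -(C 9) * X 0 * X 1 ^ 4 - C 24 * X 1 ^ 3 * X 2 + C 6 * X 0 ^ 2 * X 1 ^ 2 * X 2 +
    C 72 * X 0 * X 1 * X 2 ^ 2 + C 144 * X 2 ^ 3 - X 0 ^ 3 * X 2 ^ 2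

/-- In the affine chart `x = -3`, the only singular point of `P` with `y ≠ 0` is `(-3, 3, 3)`. -/
lemma eq_three_of_gradient_eq_zero {b c : ℂ}
    (h₀ : -9 * b ^ 4 - 36 * b ^ 2 * c + 72 * b * c ^ 2 - 27 * c ^ 2 = 0)
    (h₁ : 108 * b ^ 3 - 72 * b ^ 2 * c + 108 * b * c - 216 * c ^ 2 = 0)
    (h₂ : -24 * b ^ 3 + 54 * b ^ 2 - 432 * b * c + 432 * c ^ 2 + 54 * c = 0)
    (hb : b ≠ 0) : b = 3 ∧ c = 3 := by
  have hc : c * (24 * b ^ 2 + 36 * b - 9) = b ^ 2 * (32 * b + 9) := by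
    linear_combination (-1 / 3 : ℂ) * h₁ - h₂ / 6
  set D := 24 * b ^ 2 + 36 * b - 9
  have key₀ : (b - 3) * (9 * b ^ 2 - 26 * b - 3) = 0 := by
    have : b ^ 5 * ((b - 3) * (9 * b ^ 2 - 26 * b - 3)) = 0 := by
      linear_combination (-D ^ 2 / 576) * h₀
        - (4 * b ^ 2 * D + (3 - 8 * b) * (c * D + b ^ 2 * (32 * b + 9))) / 64 * hc
    simpa [hb] using this
  have key₁ : (b - 3) ^ 2 * (4 * b - 5) = 0 := by
    have : b ^ 4 * ((b - 3) ^ 2 * (4 * b - 5)) = 0 := by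
      linear_combination (D ^ 2 / 1728) * h₁
        - ((3 * b - 2 * b ^ 2) * D - 6 * (c * D + b ^ 2 * (32 * b + 9))) / 48 * hc
    simpa [hb] using this
  have hb3 : b = 3 := by
    by_contra h
    have h' : b - 3 ≠ 0 := sub_ne_zero.mpr h
    have e₀ : 9 * b ^ 2 - 26 * b - 3 = 0 := by simpa [h'] using key₀
    have e₁ : 4 * b - 5 = 0 := by simpa [h'] using key₁
    have : (1 : ℂ) = 0 := by
      linear_combination (-16 / 343 : ℂ) * e₀ + (36 * b - 59) / 343 * e₁
    exact one_ne_zero this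
  subst hb3
  exact ⟨rfl, by linear_combination hc / 315⟩

lemma eval_pderiv_zero_P (a b c : ℂ) : eval ![a, b, c] (pderiv 0 P) =
    -9 * b ^ 4 + 12 * a * b ^ 2 * c + 72 * b * c ^ 2 - 3 * a ^ 2 * c ^ 2 := by
  simp [P, pderiv_X]
  ring

lemma eval_pderiv_one_P (a b c : ℂ) : eval ![a, b, c] (pderiv 1 P) =
    -36 * a * b ^ 3 - 72 * b ^ 2 * c + 12 * a ^ 2 * b * c + 72 * a * c ^ 2 := by
  simp [P, pderiv_X]
  ring

lemma eval_pderiv_two_P (a b c : ℂ) : eval ![a, b, c] (pderiv 2 P) =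
    -24 * b ^ 3 + 6 * a ^ 2 * b ^ 2 + 144 * a * b * c + 432 * c ^ 2 - 2 * a ^ 3 * c := by
  simp [P, pderiv_X]
  ring

/-- The cubic in `z` obtained from `P / 144` by setting `y = 1`. -/
lemma irreducible_cubic_specialization :
    Irreducible (Cubic.toPoly ⟨1,
      Polynomial.C (1 / 144) * (72 * Polynomial.X - Polynomial.X ^ 3),
      Polynomial.C (1 / 144) * (6 * Polynomial.X ^ 2 - 24),
      Polynomial.C (1 / 144) * (-9 * Polynomial.X)⟩ : Polynomial (Polynomial ℂ)) := by
  rw [(Cubic.monic_of_a_eq_one').irreducible_iff_roots_eq_zero_of_degree_le_three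
    (by rw [Cubic.natDegree_of_a_ne_zero' one_ne_zero]; norm_num)
    (Cubic.natDegree_of_a_ne_zero' one_ne_zero).le]
  refine Multiset.eq_zero_of_forall_notMem fun r hr => ?_
  have hroot := Polynomial.isRoot_of_mem_roots hr
  have h : 144 * r ^ 3 + (72 * Polynomial.X - Polynomial.X ^ 3) * r ^ 2
      + (6 * Polynomial.X ^ 2 - 24) * r - 9 * Polynomial.X = 0 := by
    have hC : Polynomial.C (1 / 144 : ℂ) * 144 = 1 := by
      rw [show (144 : Polynomial ℂ) = Polynomial.C 144 from rfl, ← Polynomial.C_mul]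
      norm_num
    simp only [Polynomial.IsRoot, Cubic.toPoly, Polynomial.eval_add, Polynomial.eval_mul,
      Polynomial.eval_C, Polynomial.eval_pow, Polynomial.eval_X] at hroot
    linear_combination 144 * hroot - ((72 * Polynomial.X - Polynomial.X ^ 3) * r ^ 2
      + (6 * Polynomial.X ^ 2 - 24) * r - 9 * Polynomial.X) * hC
  have hdeg : r.natDegree ≤ 1 := by
    have hdvd : r ∣ Polynomial.C 9 * Polynomial.X := by
      refine ⟨144 * r ^ 2 + (72 * Polynomial.X - Polynomial.X ^ 3) * r
        + (6 * Polynomial.X ^ 2 - 24), ?_⟩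
      rw [show (Polynomial.C 9 : Polynomial ℂ) = 9 from rfl]
      linear_combination -h
    simpa using Polynomial.natDegree_le_of_dvd hdvd (by simp)
  obtain ⟨d, c, rfl⟩ := Polynomial.exists_eq_X_add_C_of_natDegree_le_one hdeg
  have hev (x : ℂ) := congrArg (Polynomial.eval x) h
  simp only [Polynomial.eval_add, Polynomial.eval_sub, Polynomial.eval_mul, Polynomial.eval_pow,
    Polynomial.eval_X, Polynomial.eval_C, Polynomial.eval_ofNat, Polynomial.eval_zero] at hev
  have hd : d = 0 := pow_eq_zero_iff two_ne_zero |>.mp (by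
    linear_combination (-1 / 120 : ℂ) * (hev 5 - 5 * hev 4 + 10 * hev 3 - 10 * hev 2
      + 5 * hev 1 - hev 0))
  subst hd
  have hc : c = 0 := pow_eq_zero_iff two_ne_zero |>.mp (by
    linear_combination (-1 / 6 : ℂ) * (hev 3 - 3 * hev 2 + 3 * hev 1 - hev 0))
  subst hc
  simpa using hev 1

lemma irreducible_P : Irreducible P := by
  let e := (renameEquiv ℂ (Equiv.swap (0 : Fin 3) 2)).trans (finSuccEquiv ℂ 2)
  let M : Cubic (MvPolynomial (Fin 2) ℂ) := ⟨1, C (1 / 144) * (72 * X 1 * X 0 - X 1 ^ 3),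
    C (1 / 144) * (6 * X 1 ^ 2 * X 0 ^ 2 - 24 * X 0 ^ 3), C (1 / 144) * (-9 * X 1 * X 0 ^ 4)⟩
  let φ : MvPolynomial (Fin 2) ℂ →+* Polynomial ℂ :=
    (aeval ![1, Polynomial.X] : MvPolynomial (Fin 2) ℂ →ₐ[ℂ] Polynomial ℂ).toRingHom
  have hM : Irreducible M.toPoly := by
    refine Polynomial.Monic.irreducible_of_irreducible_map φ _ Cubic.monic_of_a_eq_one' ?_
    rw [← Cubic.map_toPoly]
    simpa [Cubic.map, M, φ] using irreducible_cubic_specialization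
  have hu : IsUnit (Polynomial.C (C 144 : MvPolynomial (Fin 2) ℂ)) :=
    ((isUnit_iff_ne_zero.mpr (by norm_num)).map C).map Polynomial.C
  have heP : e P = Polynomial.C (C 144) * M.toPoly := by
    have h₀ : e (X 0) = Polynomial.C (X 1) := by
      simpa [e] using finSuccEquiv_X_succ (R := ℂ) (j := (1 : Fin 2))
    have h₁ : e (X 1) = Polynomial.C (X 0) := by
      simpa [e, Equiv.swap_apply_of_ne_of_ne] using finSuccEquiv_X_succ (R := ℂ) (j := (0 : Fin 2))
    have h₂ : e (X 2) = Polynomial.X := by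
      simpa [e] using finSuccEquiv_X_zero (R := ℂ) (n := 2)
    have hinv : (144 : Polynomial (MvPolynomial (Fin 2) ℂ)) * Polynomial.C (C (1 / 144)) = 1 := by
      rw [show (144 : Polynomial (MvPolynomial (Fin 2) ℂ)) = Polynomial.C (C 144) by
        simp only [map_ofNat], ← Polynomial.C_mul, ← C_mul]
      norm_num
    simp only [P, M, Cubic.toPoly, map_add, map_sub, map_mul, map_neg, map_pow, map_ofNat,
      map_one, h₀, h₁, h₂]
    linear_combination -(72 * Polynomial.C (X 1) * Polynomial.C (X 0) * Polynomial.X ^ 2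
      - Polynomial.C (X 1) ^ 3 * Polynomial.X ^ 2
      + 6 * Polynomial.C (X 1) ^ 2 * Polynomial.C (X 0) ^ 2 * Polynomial.X
      - 24 * Polynomial.C (X 0) ^ 3 * Polynomial.X
      - 9 * Polynomial.C (X 1) * Polynomial.C (X 0) ^ 4) * hinv
  rw [← MulEquiv.irreducible_iff e, heP, irreducible_isUnit_mul hu]
  exact hM

/-- (a) `P` is irreducible in `ℂ[x,y,z]`; (b) a nonzero point `(a,b,c) ∈ ℂ³`
is a common zero of the three partial derivatives of `P` iff it is of the form
`(t,0,0)` or `(-3t, 3t², 3t³)` with `t ≠ 0`.  (Hence the hypersurface `Z(P)`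
in the weighted projective plane `ℙ(1,2,3)` is singular precisely at the points
`(1:0:0)` and `(-3:3:3)`.) -/
theorem P_irreducible_and_singular_locus :
    Irreducible P ∧
    ∀ a b c : ℂ, (a, b, c) ≠ (0, 0, 0) →
      ((eval ![a, b, c] (pderiv 0 P) = 0 ∧ eval ![a, b, c] (pderiv 1 P) = 0 ∧
          eval ![a, b, c] (pderiv 2 P) = 0) ↔
        ((∃ t : ℂ, t ≠ 0 ∧ (a, b, c) = (t, 0, 0)) ∨
         (∃ t : ℂ, t ≠ 0 ∧ (a, b, c) = (-3 * t, 3 * t ^ 2, 3 * t ^ 3)))) := by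
  refine ⟨irreducible_P, fun a b c hne => ?_⟩
  rw [eval_pderiv_zero_P, eval_pderiv_one_P, eval_pderiv_two_P]
  constructor
  · rintro ⟨h₀, h₁, h₂⟩
    have hc_of_b (hb : b = 0) : c = 0 := by
      subst hb
      by_contra hc
      have ha : a = 0 := by simpa [hc] using h₀
      simp [ha, hc] at h₂
    have ha : a ≠ 0 := by
      rintro rfl
      have hb : b = 0 := by
        by_contra hb
        have hc : c = 0 := by simpa [hb] using h₁
        simp [hc, hb] at h₂
      exact hne (by rw [hb, hc_of_b hb])
    by_cases hb : b = 0
    · exact Or.inl ⟨a, ha, by rw [hb, hc_of_b hb]⟩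
    · right
      obtain ⟨t, rfl⟩ : ∃ t, a = -3 * t := ⟨-a / 3, by ring⟩
      have ht : t ≠ 0 := by simpa using ha
      obtain ⟨b, rfl⟩ : ∃ B, b = B * t ^ 2 := ⟨b / t ^ 2, by field_simp⟩
      obtain ⟨c, rfl⟩ : ∃ C, c = C * t ^ 3 := ⟨c / t ^ 3, by field_simp⟩
      obtain ⟨rfl, rfl⟩ : b = 3 ∧ c = 3 := by
        refine eq_three_of_gradient_eq_zero ?_ ?_ ?_ (left_ne_zero_of_mul hb)
        · exact (mul_eq_zero.mp (by linear_combination h₀ :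
            t ^ 8 * _ = 0)).resolve_left (pow_ne_zero _ ht)
        · exact (mul_eq_zero.mp (by linear_combination h₁ :
            t ^ 7 * _ = 0)).resolve_left (pow_ne_zero _ ht)
        · exact (mul_eq_zero.mp (by linear_combination h₂ :
            t ^ 6 * _ = 0)).resolve_left (pow_ne_zero _ ht)
      exact ⟨t, ht, rfl⟩
  · rintro (⟨t, -, h⟩ | ⟨t, -, h⟩) <;> obtain ⟨rfl, rfl, rfl⟩ := by simpa using h
    · simp
    · refine ⟨?_, ?_, ?_⟩ <;> ring

end
end
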